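/- arXiv:2505.08557 — 3 statements merged into one kernel-verified Lean document; each statement's English description precedes it below -/
import Mathlib

section
/- Let a, c > 0, b ≥ 0 and x ≥ 0 be real numbers such that x − √(a·x + b) ≤ c. Then x ≤ a + c + 2·√(b + a·c). -/
/-- Let a, c > 0, b ≥ 0 and x ≥ 0 be real numbers such that x − √(a·x + b) ≤ c.
Then x ≤ a + c + 2·√(b + a·c). -/
theorem stmt_0 (a b c x : ℝ) (ha : 0 < a) (hb : 0 ≤ b) (hc : 0 < c) (hx : 0 ≤ x)
    (h : x - Real.sqrt (a * x + b) ≤ c) :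
    x ≤ a + c + 2 * Real.sqrt (b + a * c) := by
  by_contra hcon
  push Not at hcon
  have hs0 := Real.sqrt_nonneg (b + a * c)
  have hs := Real.sq_sqrt (show 0 ≤ b + a * c by positivity)
  have ht0 := Real.sqrt_nonneg (a * x + b)
  have ht := Real.sq_sqrt (show 0 ≤ a * x + b by positivity)
  set s := Real.sqrt (b + a * c)
  set t := Real.sqrt (a * x + b)
  have h1 : (x - c) ^ 2 ≤ t ^ 2 := pow_le_pow_left₀ (by linarith) (by linarith) 2
  have h2 : (2 * s) * (2 * s) < (x - c) * (x - c - a) :=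
    mul_lt_mul'' (by linarith) (by linarith) (by linarith) (by linarith)
  nlinarith [sq_nonneg s]
end

section
/- Let E be a real Hilbert space and let f : E → ℝ be differentiable, μ-strongly convex and β-smooth with 0 < μ ≤ β < ∞. Then for step size η = 2/(μ + β), the gradient-descent map ψ(w) = w − η·∇f(w) is a contraction with factor γ = (β − μ)/(β + μ): ‖ψ(w) − ψ(w′)‖ ≤ γ·‖w − w′‖ for all w, w′ ∈ E. -/
open scoped RealInnerProductSpace

theorem aux_descent {E : Type*} [NormedAddCommGroup E] [InnerProductSpace ℝ E] [CompleteSpace E]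
    (f : E → ℝ) (g : E → E) (β : ℝ)
    (hgrad : ∀ x : E, HasGradientAt f (g x) x)
    (hsmooth : ∀ x y : E, ‖g x - g y‖ ≤ β * ‖x - y‖) (y v : E) :
    f (y + v) ≤ f y + ⟪g y, v⟫ + β / 2 * ‖v‖ ^ 2 := by
  have hd : ∀ t : ℝ, HasDerivAt (fun t : ℝ => f (y + t • v) - t * ⟪g y, v⟫ - β / 2 * ‖v‖ ^ 2 * t ^ 2)
      (⟪g (y + t • v), v⟫ - ⟪g y, v⟫ - β * ‖v‖ ^ 2 * t) t := by
    intro t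
    have h1 : HasDerivAt (fun t : ℝ => y + t • v) v t := by
      simpa using ((hasDerivAt_id t).smul_const v).const_add y
    have h2 := (hgrad (y + t • v)).hasFDerivAt.comp_hasDerivAt t h1
    have h3 : HasDerivAt (fun t : ℝ => t * ⟪g y, v⟫) ⟪g y, v⟫ t := by
      simpa using (hasDerivAt_id t).mul_const ⟪g y, v⟫
    have h4 : HasDerivAt (fun t : ℝ => β / 2 * ‖v‖ ^ 2 * t ^ 2) (β * ‖v‖ ^ 2 * t) t := by
      have := (hasDerivAt_pow 2 t).const_mul (β / 2 * ‖v‖ ^ 2)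
      refine this.congr_deriv ?_
      norm_num
      ring
    have h5 := (h2.sub h3).sub h4
    refine HasDerivAt.congr_deriv (f' := _) h5 ?_
    simp
  have hanti := antitoneOn_of_deriv_nonpos (convex_Ici (0 : ℝ))
    (fun t _ => (hd t).continuousAt.continuousWithinAt)
    (fun t _ => (hd t).differentiableAt.differentiableWithinAt)
    (by
      intro t ht
      rw [interior_Ici] at ht
      have ht0 : 0 < t := ht
      rw [(hd t).deriv]
      have h1 := hsmooth (y + t • v) y
      rw [add_sub_cancel_left, norm_smul, Real.norm_of_nonneg ht0.le] at h1
      have h2 := real_inner_le_norm (g (y + t • v) - g y) v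
      rw [inner_sub_left] at h2
      have h3 := mul_le_mul_of_nonneg_right h1 (norm_nonneg v)
      nlinarith)
  have := hanti (Set.mem_Ici.2 le_rfl) (Set.mem_Ici.2 zero_le_one) zero_le_one
  simp at this
  linarith

theorem aux_coco {E : Type*} [NormedAddCommGroup E] [InnerProductSpace ℝ E] [CompleteSpace E]
    (f : E → ℝ) (g : E → E) (μ β : ℝ)
    (hgrad : ∀ x : E, HasGradientAt f (g x) x)
    (hsc : ∀ x y : E, f x ≥ f y + ⟪g y, x - y⟫ + μ / 2 * ‖x - y‖ ^ 2)
    (hsmooth : ∀ x y : E, ‖g x - g y‖ ≤ β * ‖x - y‖) (x y d : E)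
    (hd : g x - g y = d + μ • (x - y)) (t : ℝ) :
    2 * t * ‖d‖ ^ 2 - (β - μ) * t ^ 2 * ‖d‖ ^ 2 ≤ ⟪d, x - y⟫ := by
  have a1 := aux_descent f g β hgrad hsmooth x (-(t • d))
  have a2 := hsc (x + -(t • d)) y
  have b1 := aux_descent f g β hgrad hsmooth y (t • d)
  have b2 := hsc (y + t • d) x
  have e1 : x + -(t • d) - y = (x - y) - t • d := by abel
  have e2 : y + t • d - x = -((x - y) - t • d) := by abel
  rw [e1] at a2
  rw [e2] at b2
  have c1 : ⟪g x, x - y⟫ - ⟪g y, x - y⟫ = ⟪d, x - y⟫ + μ * ‖x - y‖ ^ 2 := by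
    rw [← inner_sub_left, hd, inner_add_left, real_inner_smul_left, real_inner_self_eq_norm_sq]
  have c2 : ⟪g x, d⟫ - ⟪g y, d⟫ = ‖d‖ ^ 2 + μ * ⟪d, x - y⟫ := by
    rw [← inner_sub_left, hd, inner_add_left, real_inner_smul_left, real_inner_self_eq_norm_sq,
      real_inner_comm]
  generalize x - y = v at *
  have n1 : ‖t • d‖ ^ 2 = t ^ 2 * ‖d‖ ^ 2 := by
    rw [norm_smul, mul_pow, Real.norm_eq_abs, sq_abs]
  have n2 : ‖v - t • d‖ ^ 2 = ‖v‖ ^ 2 - 2 * t * ⟪d, v⟫ + t ^ 2 * ‖d‖ ^ 2 := by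
    rw [norm_sub_sq_real, n1, real_inner_smul_right, real_inner_comm]
    ring
  simp only [norm_neg, n1, n2, inner_neg_right, inner_sub_right, real_inner_smul_right] at a1 a2 b1 b2
  have c3 : t * ⟪g x, d⟫ - t * ⟪g y, d⟫ = t * (‖d‖ ^ 2 + μ * ⟪d, v⟫) := by
    rw [← c2]; ring
  linarith

/-- If `f` is a differentiable, `μ`-strongly convex, `β`-smooth function on a
real Hilbert space (with gradient `g`, `0 < μ ≤ β`), then with step size
`η = 2/(μ+β)` the gradient-descent map `ψ w = w − η • g w` is a contraction
with factor `γ = (β − μ)/(β + μ)`. -/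
theorem stmt_5 {E : Type*} [NormedAddCommGroup E] [InnerProductSpace ℝ E] [CompleteSpace E]
    (f : E → ℝ) (g : E → E) (μ β : ℝ) (hμ : 0 < μ) (hμβ : μ ≤ β)
    (hgrad : ∀ x : E, HasGradientAt f (g x) x)
    (hsc : ∀ x y : E, f x ≥ f y + ⟪g y, x - y⟫ + μ / 2 * ‖x - y‖ ^ 2)
    (hsmooth : ∀ x y : E, ‖g x - g y‖ ≤ β * ‖x - y‖)
    (ψ : E → E) (hψ : ∀ w, ψ w = w - (2 / (μ + β)) • g w) :
    ∀ w w' : E, ‖ψ w - ψ w'‖ ≤ (β - μ) / (β + μ) * ‖w - w'‖ := by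
  intro w w'
  obtain ⟨d, hd⟩ : ∃ d, g w - g w' = d + μ • (w - w') :=
    ⟨g w - g w' - μ • (w - w'), by abel⟩
  have key := aux_coco f g μ β hgrad hsc hsmooth w w' d hd
  have hS : 0 < β + μ := by linarith
  have hL : 0 ≤ β - μ := by linarith
  have hc : ‖d‖ ^ 2 ≤ (β - μ) * ⟪d, w - w'⟫ := by
    rcases hL.eq_or_lt with h0 | h0
    · rw [← h0] at key ⊢
      by_contra hcon
      have hp : 0 < ‖d‖ ^ 2 := by linarith
      have := key ((⟪d, w - w'⟫ + 1) / (2 * ‖d‖ ^ 2))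
      have e : 2 * ((⟪d, w - w'⟫ + 1) / (2 * ‖d‖ ^ 2)) * ‖d‖ ^ 2 = ⟪d, w - w'⟫ + 1 := by
        generalize ‖d‖ ^ 2 = q at hp
        field_simp
      rw [e] at this
      linarith
    · have := key (1 / (β - μ))
      have e : 2 * (1 / (β - μ)) * ‖d‖ ^ 2 - (β - μ) * (1 / (β - μ)) ^ 2 * ‖d‖ ^ 2
          = ‖d‖ ^ 2 / (β - μ) := by
        field_simp
        ring
      rw [e, div_le_iff₀ h0] at this
      linarith
  have e : ψ w - ψ w' = (1 / (β + μ)) • ((β - μ) • (w - w') - (2 : ℝ) • d) := by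
    have hd' : d = g w - g w' - μ • (w - w') := by rw [hd]; abel
    rw [hψ, hψ, hd', add_comm μ β]
    match_scalars <;> field_simp <;> ring
  have hn : ‖(β - μ) • (w - w') - (2 : ℝ) • d‖ ≤ (β - μ) * ‖w - w'‖ := by
    refine (sq_le_sq₀ (norm_nonneg _) (mul_nonneg hL (norm_nonneg _))).1 ?_
    rw [norm_sub_sq_real, norm_smul, norm_smul, real_inner_smul_left, real_inner_smul_right,
      real_inner_comm, Real.norm_of_nonneg hL, Real.norm_of_nonneg zero_le_two]
    nlinarith
  rw [e, norm_smul, Real.norm_of_nonneg (by positivity)]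
  calc _ ≤ 1 / (β + μ) * ((β - μ) * ‖w - w'‖) := by gcongr
    _ = _ := by ring
end

section
/- Let E be a real Hilbert space and let f : E → ℝ be differentiable, μ-strongly convex and β-smooth with 0 < μ ≤ β < ∞. Let w⋆ ∈ E satisfy ∇f(w⋆) = 0, and define the gradient-descent sequence w_{t+1} = w_t − (2/(μ + β))·∇f(w_t) from any initial point w₀. Then for every t ≥ 0, ‖w_t − w⋆‖ ≤ γ^t · ‖w₀ − w⋆‖, where γ = (β − μ)/(β + μ). -/
open scoped RealInnerProductSpace

theorem descent_aux {E : Type*} [NormedAddCommGroup E] [InnerProductSpace ℝ E] [CompleteSpace E]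
    (f : E → ℝ) (g : E → E) (β : ℝ)
    (hgrad : ∀ x : E, HasGradientAt f (g x) x)
    (hsmooth : ∀ x y : E, ‖g x - g y‖ ≤ β * ‖x - y‖) (x v : E) :
    f (x + v) ≤ f x + ⟪g x, v⟫ + β / 2 * ‖v‖ ^ 2 := by
  have hd : ∀ t : ℝ, HasDerivAt (fun t : ℝ => f (x + t • v) - t * ⟪g x, v⟫ - β / 2 * ‖v‖ ^ 2 * t ^ 2)
      (⟪g (x + t • v), v⟫ - ⟪g x, v⟫ - β * ‖v‖ ^ 2 * t) t := by
    intro t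
    have h1 : HasDerivAt (fun t : ℝ => x + t • v) v t := by
      simpa using ((hasDerivAt_id t).smul_const v).const_add x
    have h2 : HasDerivAt (fun t : ℝ => f (x + t • v)) ⟪g (x + t • v), v⟫ t := by
      have := (hgrad (x + t • v)).hasFDerivAt.comp_hasDerivAt t h1
      refine HasDerivAt.congr_deriv (f := fun t : ℝ => f (x + t • v)) this ?_
      simp
    have h3 := (h2.sub ((hasDerivAt_id t).mul_const ⟪g x, v⟫)).sub
      (((hasDerivAt_id t).pow 2).const_mul (β / 2 * ‖v‖ ^ 2))
    refine h3.congr_deriv ?_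
    simp
    ring
  have hanti := antitoneOn_of_deriv_nonpos (convex_Icc (0 : ℝ) 1)
    (fun t _ => (hd t).continuousAt.continuousWithinAt)
    (fun t _ => (hd t).differentiableAt.differentiableWithinAt)
    (by
      intro t ht
      rw [interior_Icc] at ht
      rw [(hd t).deriv, ← inner_sub_left]
      have h1 := real_inner_le_norm (g (x + t • v) - g x) v
      have h2 := hsmooth (x + t • v) x
      rw [add_sub_cancel_left, norm_smul, Real.norm_of_nonneg ht.1.le] at h2
      nlinarith [mul_le_mul_of_nonneg_right h2 (norm_nonneg v)])
  have := hanti (Set.left_mem_Icc.2 zero_le_one) (Set.right_mem_Icc.2 zero_le_one) zero_le_one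
  simp at this
  linarith

theorem coco_aux {E : Type*} [NormedAddCommGroup E] [InnerProductSpace ℝ E] [CompleteSpace E]
    (f : E → ℝ) (g : E → E) (μ β : ℝ) (hμ : 0 < μ) (hμβ : μ ≤ β)
    (hgrad : ∀ x : E, HasGradientAt f (g x) x)
    (hsc : ∀ x y : E, f x ≥ f y + ⟪g y, x - y⟫ + μ / 2 * ‖x - y‖ ^ 2)
    (hsmooth : ∀ x y : E, ‖g x - g y‖ ≤ β * ‖x - y‖) (x y : E) :
    ‖g x - g y‖ ^ 2 + β * μ * ‖x - y‖ ^ 2 ≤ (β + μ) * ⟪g x - g y, x - y⟫ := by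
  rcases hμβ.eq_or_lt with h | h
  · subst h
    have h1 := hsc x y
    have h2 := hsc y x
    rw [norm_sub_rev y x, ← neg_sub x y, inner_neg_right] at h2
    have h3 := hsmooth x y
    have h4 : ‖g x - g y‖ ^ 2 ≤ (μ * ‖x - y‖) ^ 2 := by gcongr
    rw [inner_sub_left]
    nlinarith
  · have key : ∀ (x y : E) (s : ℝ),
        f y + ⟪g y, x - y⟫ + μ / 2 * ‖x - y‖ ^ 2
          + s * (⟪g x - g y, (g x - g y) - μ • (x - y)⟫ - μ * ⟪x - y, (g x - g y) - μ • (x - y)⟫)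
          ≤ f x + (β - μ) / 2 * s ^ 2 * ‖(g x - g y) - μ • (x - y)‖ ^ 2 := by
      intro x y s
      generalize hd : (g x - g y) - μ • (x - y) = d
      have h1 := descent_aux f g β hgrad hsmooth x (-(s • d))
      have h2 := hsc (x + -(s • d)) y
      have e : x + -(s • d) - y = (x - y) - s • d := by abel
      rw [e, norm_sub_sq_real, inner_sub_right, inner_smul_right, inner_smul_right, norm_smul,
        mul_pow, Real.norm_eq_abs, sq_abs] at h2
      rw [norm_neg, inner_neg_right, inner_smul_right, norm_smul,
        mul_pow, Real.norm_eq_abs, sq_abs] at h1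
      rw [inner_sub_left (g x)]
      nlinarith
    have k1 := key x y (1 / (β - μ))
    have k2 := key y x (1 / (β - μ))
    have e : (g y - g x) - μ • (y - x) = -((g x - g y) - μ • (x - y)) := by
      rw [← neg_sub x y, ← neg_sub (g x) (g y), smul_neg]; abel
    rw [e, ← neg_sub x y, ← neg_sub (g x) (g y)] at k2
    simp only [inner_neg_neg, norm_neg, inner_neg_right (g x)] at k2
    have hs : (β - μ) / 2 * (1 / (β - μ)) ^ 2 = (1 / (β - μ)) / 2 := by
      have : β - μ ≠ 0 := by linarith
      field_simp
    rw [hs] at k1 k2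
    have hi : ⟪g x, x - y⟫ - ⟪g y, x - y⟫ = ⟪g x - g y, x - y⟫ := (inner_sub_left _ _ _).symm
    generalize x - y = v at *
    generalize g x - g y = a at *
    have hp : 0 < β - μ := by linarith
    have hm : (β - μ) * (1 / (β - μ)) = 1 := by field_simp
    generalize 1 / (β - μ) = s at *
    simp only [norm_sub_sq_real, inner_sub_right, inner_smul_right, norm_smul, mul_pow,
      Real.norm_eq_abs, sq_abs, real_inner_self_eq_norm_sq, real_inner_comm a v] at k1 k2
    have k3 : s * (‖a‖ ^ 2 - 2 * (μ * ⟪a, v⟫) + μ ^ 2 * ‖v‖ ^ 2) ≤ ⟪a, v⟫ - μ * ‖v‖ ^ 2 := by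
      nlinarith
    have k4 := mul_le_mul_of_nonneg_left k3 hp.le
    rw [← mul_assoc, hm] at k4
    linarith

/-- Convergence of gradient descent for a `μ`-strongly convex, `β`-smooth
function (with gradient `g`, `0 < μ ≤ β`): if `∇f(w⋆) = 0` and
`w (t+1) = w t − (2/(μ+β)) • g (w t)`, then
`‖w t − w⋆‖ ≤ γ^t · ‖w 0 − w⋆‖` with `γ = (β − μ)/(β + μ)`. -/
theorem stmt_9 {E : Type*} [NormedAddCommGroup E] [InnerProductSpace ℝ E] [CompleteSpace E]
    (f : E → ℝ) (g : E → E) (μ β : ℝ) (hμ : 0 < μ) (hμβ : μ ≤ β)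
    (hgrad : ∀ x : E, HasGradientAt f (g x) x)
    (hsc : ∀ x y : E, f x ≥ f y + ⟪g y, x - y⟫ + μ / 2 * ‖x - y‖ ^ 2)
    (hsmooth : ∀ x y : E, ‖g x - g y‖ ≤ β * ‖x - y‖)
    (wstar : E) (hstar : g wstar = 0)
    (w : ℕ → E) (hw : ∀ t : ℕ, w (t + 1) = w t - (2 / (μ + β)) • g (w t)) :
    ∀ t : ℕ, ‖w t - wstar‖ ≤ ((β - μ) / (β + μ)) ^ t * ‖w 0 - wstar‖ := by
  have hp : 0 < μ + β := by linarith
  have step : ∀ t, ‖w (t + 1) - wstar‖ ≤ (β - μ) / (β + μ) * ‖w t - wstar‖ := by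
    intro t
    have h := coco_aux f g μ β hμ hμβ hgrad hsc hsmooth (w t) wstar
    rw [hstar, sub_zero] at h
    have e : w (t + 1) - wstar = (w t - wstar) - (2 / (μ + β)) • g (w t) := by rw [hw]; abel
    have hg : 0 ≤ (β - μ) / (β + μ) := div_nonneg (by linarith) (by linarith)
    refine (pow_le_pow_iff_left₀ (norm_nonneg _) (mul_nonneg hg (norm_nonneg _)) two_ne_zero).1 ?_
    rw [e, norm_sub_sq_real, inner_smul_right, norm_smul, mul_pow, Real.norm_eq_abs, sq_abs,
      real_inner_comm, mul_pow]
    have h2 := mul_le_mul_of_nonneg_left h (show 0 ≤ 4 / (μ + β) ^ 2 by positivity)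
    have e1 : 4 / (μ + β) ^ 2 * ((β + μ) * ⟪g (w t), w t - wstar⟫) =
        2 * (2 / (μ + β) * ⟪g (w t), w t - wstar⟫) := by
      field_simp; ring
    have e2 : ((β - μ) / (β + μ)) ^ 2 = 1 - 4 / (μ + β) ^ 2 * (β * μ) := by
      rw [add_comm β μ]; field_simp; ring
    have e3 : (2 / (μ + β)) ^ 2 = 4 / (μ + β) ^ 2 := by rw [div_pow]; norm_num
    rw [e1] at h2
    rw [e2, e3]
    linarith
  intro t
  induction t with
  | zero => simp
  | succ n ih =>
    have hg : 0 ≤ (β - μ) / (β + μ) := div_nonneg (by linarith) (by linarith)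
    calc _ ≤ _ := step n
      _ ≤ (β - μ) / (β + μ) * (((β - μ) / (β + μ)) ^ n * ‖w 0 - wstar‖) := by gcongr
      _ = _ := by rw [pow_succ]; ring
end
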